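/- arXiv:1801.08664 — 4 statements merged into one kernel-verified Lean document; each statement's English description precedes it below -/
import Mathlib

section
/- Let a and b be binary sequences of period N and let u = I(a,b) be their interleaved sequence of period 2N. Then for 0 ≤ τ < 2N: if τ is even, R_u(τ) = R_a(τ/2) + R_b(τ/2); and if τ is odd, R_u(τ) = R_{a,b}((τ−1)/2) + R_{b,a}((τ+1)/2). -/
open Finset Polynomial

def corr (n : ℕ) (a b : ℤ → ℕ) (τ : ℤ) : ℤ :=
  ∑ i ∈ Finset.range n, (-1 : ℤ) ^ (a i + b ((i : ℤ) + τ))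

theorem sum_range_two_mul {M : Type*} [AddCommMonoid M] (f : ℕ → M) (n : ℕ) :
    ∑ i ∈ Finset.range (2 * n), f i = ∑ i ∈ Finset.range n, (f (2 * i) + f (2 * i + 1)) := by
  induction n with
  | zero => simp
  | succ n ih =>
    rw [show 2 * (n + 1) = 2 * n + 1 + 1 by ring, Finset.sum_range_succ, Finset.sum_range_succ,
      Finset.sum_range_succ, ih, add_assoc]

/-- autocorrelation of the interleaved sequence `u = I(a,b)`. -/
theorem stmt0 (N : ℕ) (hN : 0 < N) (a b u : ℤ → ℕ)
    (ha01 : ∀ i : ℤ, a i = 0 ∨ a i = 1) (hb01 : ∀ i : ℤ, b i = 0 ∨ b i = 1)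
    (haper : ∀ i : ℤ, a (i + (N : ℤ)) = a i) (hbper : ∀ i : ℤ, b (i + (N : ℤ)) = b i)
    (hu0 : ∀ i : ℤ, u (2 * i) = a i) (hu1 : ∀ i : ℤ, u (2 * i + 1) = b i)
    (τ : ℤ) (hτ0 : 0 ≤ τ) (hτ : τ < 2 * N) :
    (Even τ → corr (2 * N) u u τ = corr N a a (τ / 2) + corr N b b (τ / 2)) ∧
    (Odd τ → corr (2 * N) u u τ = corr N a b ((τ - 1) / 2) + corr N b a ((τ + 1) / 2)) := by
  unfold corr
  rw [sum_range_two_mul]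
  refine ⟨?_, ?_⟩
  · rintro ⟨k, rfl⟩
    rw [← Finset.sum_add_distrib, show (k + k) / 2 = k by omega]
    refine Finset.sum_congr rfl fun i _ => ?_
    push_cast
    rw [show 2 * (i : ℤ) + (k + k) = 2 * (i + k) by ring,
      show 2 * (i : ℤ) + 1 + (k + k) = 2 * (i + k) + 1 by ring, hu0, hu0, hu1, hu1]
  · rintro ⟨k, rfl⟩
    rw [← Finset.sum_add_distrib, show (2 * k + 1 - 1) / 2 = k by omega,
      show (2 * k + 1 + 1) / 2 = k + 1 by omega]
    refine Finset.sum_congr rfl fun i _ => ?_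
    push_cast
    rw [show 2 * (i : ℤ) + (2 * k + 1) = 2 * (i + k) + 1 by ring,
      show 2 * (i : ℤ) + 1 + (2 * k + 1) = 2 * (i + (k + 1)) by ring, hu0, hu0, hu1, hu1]
end

section
/- For every τ with 0 < τ < N, the autocorrelation values of u′ and u coincide: R_{u′}(τ) = R_u(τ). -/
open Finset Polynomial

def Dclass (N f : ℕ) (β : ZMod N) (j : ℕ) : Set (ZMod N) :=
  {x | ∃ k < f, x = β ^ (4 * k + j)}

open Classical in
/-- The binary sequence of period `N` whose characteristic set is `S ⊆ Z_N`. -/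
noncomputable def chiSeq (N : ℕ) (S : Set (ZMod N)) : ℤ → ℕ :=
  fun t => if (t : ZMod N) ∈ S then 1 else 0

open Classical in
/-- The `±1`-valued function that is `-1` exactly on `S`. -/
noncomputable def signFun {α : Type*} (S : Set α) : α → ℤ :=
  fun x => if x ∈ S then -1 else 1

theorem neg_one_pow_chiSeq (N : ℕ) (S : Set (ZMod N)) (t : ℤ) :
    (-1 : ℤ) ^ chiSeq N S t = signFun S (t : ZMod N) := by
  unfold chiSeq signFun
  split_ifs <;> simp

theorem corr_chiSeq (N : ℕ) [NeZero N] (S T : Set (ZMod N)) (τ : ℤ) :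
    corr N (chiSeq N S) (chiSeq N T) τ = ∑ x : ZMod N, signFun S x * signFun T (x + τ) := by
  refine Finset.sum_nbij' (fun i : ℕ => (i : ZMod N)) ZMod.val ?_ ?_ ?_ ?_ ?_
  · simp
  · intro x _
    exact Finset.mem_range.2 x.val_lt
  · intro i hi
    exact ZMod.val_cast_of_lt (Finset.mem_range.1 hi)
  · intro x _
    exact ZMod.natCast_zmod_val x
  · intro i _
    simp [pow_add, neg_one_pow_chiSeq]

/-- Adjoining `0` to a set `A` preserves the autocorrelation at `t ≠ 0` whenever exactly one of
`t`, `-t` lies in `A`. -/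
theorem sum_signFun_insert_zero {G : Type*} [AddCommGroup G] [Fintype G] {A : Set G} {t : G}
    (h0 : (0 : G) ∉ A) (ht : t ≠ 0) (hA : -t ∈ A ↔ t ∉ A) :
    ∑ x, signFun (insert 0 A) x * signFun (insert 0 A) (x + t)
      = ∑ x, signFun A x * signFun A (x + t) := by
  classical
  have hins (x : G) : signFun (insert 0 A) x = signFun A x - if x = 0 then 2 else 0 := by
    by_cases hx : x = 0
    · simp [signFun, hx, h0]
    · simp [signFun, hx]
  have hneg : signFun A t + signFun A (-t) = 0 := by
    by_cases h : t ∈ A <;> simp [signFun, hA, h]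
  have hsplit (x : G) : signFun (insert 0 A) x * signFun (insert 0 A) (x + t)
      = signFun A x * signFun A (x + t) - (if x = 0 then 2 * signFun A t else 0)
        - (if x = -t then 2 * signFun A (-t) else 0) := by
    rw [hins, hins]
    by_cases hx : x = 0
    · subst hx
      simp [ht, sub_mul]
    · by_cases hx' : x = -t
      · subst hx'
        simp [ht, mul_sub]
        ring
      · simp [hx, hx', add_eq_zero_iff_eq_neg]
  simp only [hsplit, Finset.sum_sub_distrib, Finset.sum_ite_eq', Finset.mem_univ, if_true]
  linarith

theorem zero_notMem_Dclass {N f : ℕ} [Fact N.Prime] {β : ZMod N} (hβ : β ≠ 0) (j : ℕ) :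
    (0 : ZMod N) ∉ Dclass N f β j := by
  rintro ⟨k, -, h⟩
  exact pow_ne_zero _ hβ h.symm

theorem pow_mem_Dclass_iff {N f : ℕ} (hf : 0 < f) {b : (ZMod N)ˣ} (hb : orderOf b = 4 * f)
    {j : ℕ} (hj : j < 4) (m : ℕ) : (b : ZMod N) ^ m ∈ Dclass N f b j ↔ m % 4 = j := by
  have hpow (k : ℕ) : (b : ZMod N) ^ m = (b : ZMod N) ^ k ↔ m ≡ k [MOD 4 * f] := by
    rw [← hb, ← pow_eq_pow_iff_modEq]
    norm_cast
  constructor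
  · rintro ⟨k, -, h⟩
    have := ((hpow _).1 h).of_mul_right f
    unfold Nat.ModEq at this
    omega
  · intro h
    refine ⟨m / 4 % f, Nat.mod_lt _ hf, (hpow _).2 ?_⟩
    have hm : m = 4 * (m / 4) + j := by omega
    conv_lhs => rw [hm]
    exact (((Nat.mod_modEq (m / 4) f).symm).mul_left' 4).add_right j

/-- If `f` is odd, then `-1` lies in the class `D₂`, so negation exchanges `D₀ ∪ D₁` with
`D₂ ∪ D₃`. -/
theorem neg_mem_Dclass_union_iff {N f : ℕ} [Fact N.Prime] (hNf : N = 4 * f + 1) (hf : Odd f)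
    {b : (ZMod N)ˣ} (hb : orderOf b = 4 * f) {x : ZMod N} (hx : x ≠ 0) :
    -x ∈ Dclass N f b 0 ∪ Dclass N f b 1 ↔ x ∉ Dclass N f b 0 ∪ Dclass N f b 1 := by
  have hgen : ∀ g : (ZMod N)ˣ, g ∈ Subgroup.zpowers b := by
    have hcard : Nat.card (ZMod N)ˣ = 4 * f := by
      rw [Nat.card_eq_fintype_card, ZMod.card_units, hNf, Nat.add_sub_cancel]
    have := Subgroup.eq_top_of_card_eq (Subgroup.zpowers b)
      (by rw [Nat.card_zpowers, hb, hcard])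
    simp [this]
  obtain ⟨m, hm⟩ : ∃ m : ℕ, b ^ m = Units.mk0 x hx :=
    mem_powers_iff_mem_zpowers.2 (hgen (Units.mk0 x hx))
  have hxm : x = (b : ZMod N) ^ m := by
    rw [← Units.val_pow_eq_pow_val, hm, Units.val_mk0]
  have hhalf : (b : ZMod N) ^ (2 * f) = -1 := by
    have hsq : ((b : ZMod N) ^ (2 * f)) ^ 2 = 1 := by
      rw [← pow_mul, ← Units.val_pow_eq_pow_val, show 2 * f * 2 = orderOf b by omega,
        pow_orderOf_eq_one, Units.val_one]
    refine (eq_or_eq_neg_of_sq_eq_sq _ 1 (by rw [hsq, one_pow])).resolve_left fun h => ?_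
    have hdvd : orderOf b ∣ 2 * f := orderOf_dvd_of_pow_eq_one (Units.ext (by simpa using h))
    have := Nat.le_of_dvd (Nat.mul_pos two_pos hf.pos) hdvd
    have := hf.pos
    omega
  have hneg : -x = (b : ZMod N) ^ (m + 2 * f) := by
    rw [pow_add, hhalf, hxm, mul_neg_one]
  obtain ⟨k, hk⟩ := hf
  simp only [Set.mem_union]
  rw [hneg, hxm]
  have hpos : 0 < f := by omega
  simp only [pow_mem_Dclass_iff hpos hb (show 0 < 4 by norm_num),
    pow_mem_Dclass_iff hpos hb (show 1 < 4 by norm_num)]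
  omega

/-- the autocorrelations of `u'` and `u` coincide for `0 < τ < N`. -/
theorem stmt2 (N f y : ℕ) (hprime : N.Prime) (hNf : N = 4 * f + 1) (hN5 : 5 ≤ N)
    (hfy : f = y ^ 2) (hy : 0 < y) (hfodd : Odd f)
    (β : ZMod N) (hβ : orderOf β = N - 1)
    (u u' : ℤ → ℕ)
    (hu : u = chiSeq N (Dclass N f β 0 ∪ Dclass N f β 1))
    (hu' : u' = chiSeq N ({0} ∪ Dclass N f β 0 ∪ Dclass N f β 1)) :
    ∀ τ : ℤ, 0 < τ → τ < N → corr N u' u' τ = corr N u u τ := by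
  have : Fact N.Prime := ⟨hprime⟩
  intro τ hτ hτN
  have ht : (τ : ZMod N) ≠ 0 := by
    rw [Ne, ZMod.intCast_zmod_eq_zero_iff_dvd]
    exact fun h => absurd (Int.le_of_dvd hτ h) (by omega)
  have hβ0 : β ≠ 0 := by
    rintro rfl
    rw [orderOf_zero] at hβ
    omega
  obtain ⟨b, rfl⟩ : ∃ b : (ZMod N)ˣ, (b : ZMod N) = β := ⟨Units.mk0 β hβ0, rfl⟩
  have hb : orderOf b = 4 * f := by
    rw [← orderOf_units, hβ, hNf, Nat.add_sub_cancel]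
  rw [hu, hu', corr_chiSeq, corr_chiSeq, Set.union_assoc, Set.singleton_union]
  refine sum_signFun_insert_zero ?_ ht (neg_mem_Dclass_union_iff hNf hfodd hb ht)
  exact fun h => h.elim (zero_notMem_Dclass hβ0 0) (zero_notMem_Dclass hβ0 1)
end

section
/- For every τ with 0 ≤ τ < N, the cross-correlation of v and u satisfies: R_{v,u}(τ) = −3 if τ ∈ D_0, and R_{v,u}(τ) = 1 otherwise. -/
open Finset Polynomial

/-- The units of the Gaussian integers. -/
lemma GaussianInt.eq_of_isUnit {z : GaussianInt} (hz : IsUnit z) :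
    z = 1 ∨ z = -1 ∨ z = ⟨0, 1⟩ ∨ z = ⟨0, -1⟩ := by
  have h := (Zsqrtd.norm_eq_one_iff' (by norm_num) z).mpr hz
  obtain ⟨a, b⟩ := z
  replace h : a * a + b * b = 1 := by simpa [Zsqrtd.norm_def] using h
  have ha : -1 ≤ a ∧ a ≤ 1 := ⟨by nlinarith [mul_self_nonneg b], by nlinarith [mul_self_nonneg b]⟩
  have hb : -1 ≤ b ∧ b ≤ 1 := ⟨by nlinarith [mul_self_nonneg a], by nlinarith [mul_self_nonneg a]⟩
  obtain ⟨ha₁, ha₂⟩ := ha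
  obtain ⟨hb₁, hb₂⟩ := hb
  interval_cases a <;> interval_cases b <;> simp_all [Zsqrtd.ext_iff]

section JacobiSum

variable {p : ℕ} [Fact p.Prime]

lemma sum_eq_apply_half_of_symm (hp : p ≠ 2) {A : Type*} [AddCommGroup A] (F : ZMod p → A)
    (hsymm : ∀ z, F (1 - z) = F z) (htwo : ∀ z ≠ 2⁻¹, F z + F z = 0) :
    ∑ z, F z = F 2⁻¹ := by
  have h2 : (2 : ZMod p) ≠ 0 := Ring.two_ne_zero (by rwa [ZMod.ringChar_zmod_n])
  have hfix : ∀ z : ZMod p, 1 - z = z → z = 2⁻¹ := fun z hz ↦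
    eq_inv_of_mul_eq_one_left (by linear_combination -hz)
  rw [← Finset.add_sum_erase _ _ (Finset.mem_univ (2⁻¹ : ZMod p)), add_eq_left]
  refine Finset.sum_involution (fun z _ ↦ 1 - z) (fun z hz ↦ ?_) (fun z hz _ h ↦ ?_)
    (fun z hz ↦ ?_) (fun z _ ↦ sub_sub_cancel _ _)
  · rw [hsymm, htwo z (Finset.ne_of_mem_erase hz)]
  · exact Finset.ne_of_mem_erase hz (hfix z h)
  · refine Finset.mem_erase.mpr ⟨fun h ↦ Finset.ne_of_mem_erase hz ?_, Finset.mem_univ _⟩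
    rw [← sub_sub_cancel 1 z, h]
    field_simp
    norm_num

lemma norm_jacobiSum_self (ψ : MulChar (ZMod p) GaussianInt) (hψ : ψ * ψ ≠ 1) :
    (jacobiSum ψ ψ).norm = p := by
  let φ : MulChar (ZMod p) ℂ := ψ.ringHomComp GaussianInt.toComplex
  have hφ : φ * φ ≠ 1 := by
    intro h
    refine hψ (MulChar.ext fun a ↦ GaussianInt.toComplex_injective ?_)
    have := DFunLike.congr_fun h (a : ZMod p)
    simpa [φ, MulChar.one_apply_coe] using this
  have hφ₁ : φ ≠ 1 := fun h ↦ hφ (by rw [h, one_mul])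
  have hchar : ringChar ℂ ≠ ringChar (ZMod p) := by
    rw [ZMod.ringChar_zmod_n, ringChar.eq_zero]
    exact (Fact.out : p.Prime).ne_zero.symm
  have key := jacobiSum_mul_jacobiSum_inv hchar hφ₁ hφ₁ hφ
  have hstar : jacobiSum φ⁻¹ φ⁻¹ = starRingEnd ℂ (jacobiSum φ φ) := by
    rw [← MulChar.star_eq_inv, ← jacobiSum_ringHomComp]
    rfl
  rw [hstar, Complex.mul_conj, jacobiSum_ringHomComp, ← GaussianInt.intCast_complex_norm,
    ZMod.card] at key
  exact_mod_cast key

lemma isUnit_mulChar_mul_one_sub (ψ : MulChar (ZMod p) GaussianInt) {z : ZMod p}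
    (h0 : z ≠ 0) (h1 : z ≠ 1) : IsUnit (ψ z * ψ (1 - z)) :=
  ((isUnit_iff_ne_zero.mpr h0).map ψ).mul
    ((isUnit_iff_ne_zero.mpr (sub_ne_zero.mpr h1.symm)).map ψ)

lemma mulChar_half_mul_half (ψ : MulChar (ZMod p) GaussianInt) (hp : p ≠ 2)
    (hψ : ψ 2 * ψ 2 = -1) : ψ 2⁻¹ * ψ (1 - 2⁻¹) = -1 := by
  have h2 : (2 : ZMod p) ≠ 0 := Ring.two_ne_zero (by rwa [ZMod.ringChar_zmod_n])
  have h : (1 : ZMod p) - 2⁻¹ = 2⁻¹ := by field_simp; norm_num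
  have h' : ψ 2 * ψ 2⁻¹ = 1 := by rw [← map_mul, mul_inv_cancel₀ h2, map_one]
  rw [h]
  linear_combination (ψ 2⁻¹ * ψ 2⁻¹) * hψ - (ψ 2 * ψ 2⁻¹ + 1) * h'

lemma re_jacobiSum_eq_sum (ψ : MulChar (ZMod p) GaussianInt) :
    (jacobiSum ψ ψ).re = ∑ z, (ψ z * ψ (1 - z)).re :=
  map_sum (⟨⟨Zsqrtd.re, rfl⟩, fun _ _ ↦ rfl⟩ : GaussianInt →+ ℤ) _ _

lemma im_jacobiSum_eq_sum (ψ : MulChar (ZMod p) GaussianInt) :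
    (jacobiSum ψ ψ).im = ∑ z, (ψ z * ψ (1 - z)).im :=
  map_sum (⟨⟨Zsqrtd.im, rfl⟩, fun _ _ ↦ rfl⟩ : GaussianInt →+ ℤ) _ _

lemma even_im_jacobiSum (ψ : MulChar (ZMod p) GaussianInt) (hp : p ≠ 2)
    (hψ : ψ 2 * ψ 2 = -1) : Even (jacobiSum ψ ψ).im := by
  rw [← ZMod.intCast_eq_zero_iff_even, im_jacobiSum_eq_sum, Int.cast_sum,
    sum_eq_apply_half_of_symm hp (fun z ↦ ((ψ z * ψ (1 - z)).im : ZMod 2))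
      (fun z ↦ by rw [sub_sub_cancel, mul_comm]) (fun z _ ↦ CharTwo.add_self_eq_zero _),
    mulChar_half_mul_half ψ hp hψ]
  simp

lemma re_add_im_jacobiSum_modEq (ψ : MulChar (ZMod p) GaussianInt) (hp : p % 4 = 1)
    (hψ : ψ 2 * ψ 2 = -1) :
    (jacobiSum ψ ψ).re + (jacobiSum ψ ψ).im ≡ 1 [ZMOD 4] := by
  have hp2 : p ≠ 2 := by rintro rfl; simp at hp
  have hpZ : (p : ZMod 4) = 1 := by
    exact_mod_cast (ZMod.natCast_eq_natCast_iff p 1 4).mpr hp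
  have h2 : (2 : ZMod p) ≠ 0 := Ring.two_ne_zero (by rwa [ZMod.ringChar_zmod_n])
  have h2' : (2⁻¹ : ZMod p) ≠ 1 := by
    intro h
    have : (2 : ZMod p) = 1 := by rw [← inv_inv (2 : ZMod p), h, inv_one]
    exact one_ne_zero (by linear_combination this : (1 : ZMod p) = 0)
  have key := sum_eq_apply_half_of_symm hp2
    (fun z ↦ (((ψ z * ψ (1 - z)).re + (ψ z * ψ (1 - z)).im : ℤ) : ZMod 4) - 1
      + ((if z = 0 then 1 else 0) + (if z = 1 then 1 else 0)))
    (fun z ↦ by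
      rw [sub_sub_cancel, mul_comm]
      have e0 : (1 - z = 0) = (z = 1) := propext (sub_eq_zero.trans eq_comm)
      have e1 : (1 - z = 1) = (z = 0) := by rw [sub_eq_self]
      simp only [e0, e1]
      ring)
    (fun z _ ↦ by
      rcases eq_or_ne z 0 with rfl | h0
      · simp [MulChar.map_zero]
      rcases eq_or_ne z 1 with rfl | h1
      · simp [MulChar.map_zero]
      rcases GaussianInt.eq_of_isUnit (isUnit_mulChar_mul_one_sub ψ h0 h1) with h | h | h | h <;>
        rw [h] <;> simp [h0, h1] <;> decide)
  rw [mulChar_half_mul_half ψ hp2 hψ] at key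
  simp only [Finset.sum_add_distrib, Finset.sum_sub_distrib, Finset.sum_ite_eq', Finset.mem_univ,
    if_true, Finset.sum_const, Finset.card_univ, ZMod.card, nsmul_eq_mul, hpZ, inv_eq_zero, h2, h2',
    if_false] at key
  apply (ZMod.intCast_eq_intCast_iff _ _ 4).mp
  rw [re_jacobiSum_eq_sum, im_jacobiSum_eq_sum,
    ← Finset.sum_add_distrib]
  have hval : (((-1 : GaussianInt).re + (-1 : GaussianInt).im : ℤ) : ZMod 4) = -1 := by simp
  rw [hval] at key
  rw [Int.cast_sum, Int.cast_one]
  have h4 : (4 : ZMod 4) = 0 := rfl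
  linear_combination key - h4

end JacobiSum

/-- A prime of the form `1 + c²` is a sum of two squares in only one way. -/
lemma eq_one_or_eq_one_of_sq_add_sq_prime {a b c N : ℤ} (hN : Prime N) (h : a ^ 2 + b ^ 2 = N)
    (hc : N = 1 + c ^ 2) : a ^ 2 = 1 ∨ b ^ 2 = 1 := by
  have hN0 := hN.ne_zero
  have hpos : 0 < N := by rw [hc]; positivity
  have aux : ∀ x y : ℤ, x ^ 2 + y ^ 2 = N ^ 2 → N ∣ x → x = 0 ∨ y = 0 := by
    rintro x y hxy ⟨k, rfl⟩
    have hk : k ^ 2 ≤ 1 := by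
      by_contra! hk
      nlinarith [sq_nonneg y, sq_nonneg N, pow_pos hpos 2]
    rcases eq_or_ne k 0 with rfl | hk0
    · left; simp
    · right
      have : k ^ 2 = 1 := le_antisymm hk (by have := sq_pos_of_ne_zero hk0; omega)
      have : y ^ 2 = 0 := by linear_combination hxy - N ^ 2 * this
      simpa using this
  have of_dvd : ∀ d : ℤ, d ^ 2 = c ^ 2 → N ∣ a + d * b → a ^ 2 = 1 ∨ b ^ 2 = 1 := by
    intro d hd hdvd
    rcases aux (a + d * b) (b - d * a) (by rw [pow_two N]; nth_rw 1 [← h]; rw [hc, ← hd]; ring)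
      hdvd with h0 | h0
    · right
      have : N * b ^ 2 = N * 1 := by
        linear_combination b ^ 2 * hc + h - b ^ 2 * hd + (d * b - a) * h0
      exact mul_left_cancel₀ hN0 this
    · left
      have : N * a ^ 2 = N * 1 := by
        linear_combination a ^ 2 * hc + h - a ^ 2 * hd - (d * a + b) * h0
      exact mul_left_cancel₀ hN0 this
  have hdvd : N ∣ (a + c * b) * (a + -c * b) :=
    ⟨1 - b ^ 2, by linear_combination h + b ^ 2 * hc⟩
  rcases hN.dvd_or_dvd hdvd with h' | h'
  · exact of_dvd c rfl h'
  · exact of_dvd (-c) (neg_sq c) h'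

section QuarticCharacter

variable {N : ℕ} [Fact N.Prime]

/-- The Jacobi sum of a quartic character of a prime `N = 1 + 4y²`, `y` odd, at which `2` is a
quadratic non-residue. -/
lemma re_jacobiSum_self {y : ℕ} (hN : N = 4 * y ^ 2 + 1) (hy : Odd y)
    (ψ : MulChar (ZMod N) GaussianInt) (hψ2 : ψ 2 * ψ 2 = -1) (hψ : ψ * ψ ≠ 1) :
    (jacobiSum ψ ψ).re = -1 := by
  have hprime : N.Prime := Fact.out
  have hN4 : N % 4 = 1 := by omega
  have hnorm := norm_jacobiSum_self ψ hψ
  have him := even_im_jacobiSum ψ (by rintro rfl; simp at hN4) hψ2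
  have hmod := re_add_im_jacobiSum_modEq ψ hN4 hψ2
  rw [Zsqrtd.norm_def] at hnorm
  generalize (jacobiSum ψ ψ).re = a at *
  generalize (jacobiSum ψ ψ).im = b at *
  have hNZ : (N : ℤ) = 1 + (2 * y) ^ 2 := by rw [hN]; push_cast; ring
  obtain ⟨c, rfl⟩ := him
  rcases eq_one_or_eq_one_of_sq_add_sq_prime (Nat.prime_iff_prime_int.mp hprime)
    (a := a) (b := c + c) (by linear_combination hnorm) hNZ with h | h
  · have hc : c ^ 2 = (y : ℤ) ^ 2 := by linarith [hnorm, hNZ, h]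
    have hc2 : c % 2 = 1 := by
      rw [← Int.odd_iff]
      rcases sq_eq_sq_iff_eq_or_eq_neg.mp hc with rfl | rfl
      · exact_mod_cast hy
      · exact (Int.odd_coe_nat y |>.mpr hy).neg
    rcases sq_eq_sq_iff_eq_or_eq_neg.mp (h.trans (one_pow 2).symm) with rfl | rfl
    · rw [Int.ModEq] at hmod
      omega
    · rfl
  · have : (2 : ℤ) * (2 * c ^ 2) = 1 := by linear_combination h
    omega

/-- Correlation of the two sign sequences `Re ((1+i)ψ) + δ` and `-Re ((1-i)ψ) + δ` attached to an
odd Gaussian-valued character `ψ`, `δ` being the indicator of `0`. -/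
lemma sum_sign_mul_sign (ψ : MulChar (ZMod N) GaussianInt) (hneg : ψ (-1) = -1)
    (hψ : ψ * ψ ≠ 1) (t : ZMod N) :
    ∑ x, ((ψ x).re - (ψ x).im + if x = 0 then 1 else 0) *
        (-((ψ (x + t)).re + (ψ (x + t)).im) + if x + t = 0 then 1 else 0) =
      (ψ t * ψ t * jacobiSum ψ ψ).re - 2 * (ψ t).re + if t = 0 then 1 else 0 := by
  have hodd : ∀ x, ψ (-x) = -ψ x := fun x ↦ by rw [← neg_one_mul x, map_mul, hneg, neg_one_mul]
  have hcross : ∑ x, ((ψ x).re * (ψ (x + t)).im - (ψ x).im * (ψ (x + t)).re) = 0 := by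
    rw [← self_eq_neg, ← Finset.sum_neg_distrib]
    refine Fintype.sum_equiv (Equiv.subLeft (-t)) _ _ fun x ↦ ?_
    have e1 : Equiv.subLeft (-t) x = -(x + t) := by simp [sub_eq_add_neg, add_comm]
    have e2 : -(x + t) + t = -x := by ring
    rw [e1, e2, hodd, hodd]
    simp only [Zsqrtd.re_neg, Zsqrtd.im_neg]
    ring
  have hmain : ∑ x, ψ x * ψ (x + t) = -(ψ t * ψ t * jacobiSum ψ ψ) := by
    rcases eq_or_ne t 0 with rfl | ht
    · simpa [MulChar.map_zero] using MulChar.sum_eq_zero_of_ne_one hψ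
    · rw [jacobiSum, Finset.mul_sum, ← Finset.sum_neg_distrib]
      refine (Fintype.sum_equiv (Equiv.mulLeft₀ (-t) (neg_ne_zero.mpr ht)) _ _ fun z ↦ ?_).symm
      have e1 : Equiv.mulLeft₀ (-t) (neg_ne_zero.mpr ht) z = -(t * z) := by simp
      have e2 : -(t * z) + t = t * (1 - z) := by ring
      rw [e1, e2, hodd, map_mul, map_mul]
      ring
  have hre : ∑ x, (ψ x * ψ (x + t)).re = -(ψ t * ψ t * jacobiSum ψ ψ).re := by
    rw [← Zsqrtd.re_neg, ← hmain]
    exact (map_sum (⟨⟨Zsqrtd.re, rfl⟩, fun _ _ ↦ rfl⟩ : GaussianInt →+ ℤ)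
      (fun x ↦ ψ x * ψ (x + t)) Finset.univ).symm
  have hδ : ∑ x, (if x = 0 then -((ψ (x + t)).re + (ψ (x + t)).im) +
      (if x + t = 0 then 1 else 0) else 0) = -((ψ t).re + (ψ t).im) + if t = 0 then 1 else 0 := by
    rw [Finset.sum_ite_eq']
    simp
  have hδ' : ∑ x, (if x = -t then (ψ x).re - (ψ x).im else 0) = -(ψ t).re + (ψ t).im := by
    rw [Finset.sum_ite_eq']
    simp [hodd]
  have hsplit : ∀ x, ((ψ x).re - (ψ x).im + if x = 0 then 1 else 0) *
      (-((ψ (x + t)).re + (ψ (x + t)).im) + if x + t = 0 then 1 else 0) =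
      -(ψ x * ψ (x + t)).re - ((ψ x).re * (ψ (x + t)).im - (ψ x).im * (ψ (x + t)).re) +
      (if x = 0 then -((ψ (x + t)).re + (ψ (x + t)).im) +
        (if x + t = 0 then 1 else 0) else 0) +
      (if x = -t then (ψ x).re - (ψ x).im else 0) := by
    intro x
    simp only [Zsqrtd.re_mul, ← add_eq_zero_iff_eq_neg]
    split_ifs <;> ring
  rw [Finset.sum_congr rfl fun x _ ↦ hsplit x, Finset.sum_add_distrib, Finset.sum_add_distrib,
    Finset.sum_sub_distrib, Finset.sum_neg_distrib, hre, hcross, hδ, hδ']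
  ring

lemma ne_zero_of_orderOf_eq {β : ZMod N} (hβ : orderOf β = N - 1) : β ≠ 0 := by
  rintro rfl
  have h2 := (Fact.out : N.Prime).two_le
  have h1 := pow_orderOf_eq_one (0 : ZMod N)
  rw [hβ, zero_pow (by omega)] at h1
  exact zero_ne_one h1

lemma exists_pow_eq_of_orderOf_eq {β : ZMod N} (hβ : orderOf β = N - 1) {x : ZMod N}
    (hx : x ≠ 0) : ∃ m < N - 1, x = β ^ m := by
  have hβ0 := ne_zero_of_orderOf_eq hβ
  have himage : (Finset.range (N - 1)).image (β ^ ·) = Finset.univ.erase 0 := by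
    refine Finset.eq_of_subset_of_card_le (fun z hz ↦ ?_) ?_
    · obtain ⟨m, -, rfl⟩ := Finset.mem_image.mp hz
      exact Finset.mem_erase.mpr ⟨pow_ne_zero m hβ0, Finset.mem_univ _⟩
    · rw [Finset.card_image_of_injOn, Finset.card_erase_of_mem (Finset.mem_univ _),
        Finset.card_univ, ZMod.card, Finset.card_range]
      intro a ha b hb hab
      exact pow_injOn_Iio_orderOf (by simpa [hβ] using ha) (by simpa [hβ] using hb) hab
  have hmem := Finset.mem_erase.mpr ⟨hx, Finset.mem_univ x⟩
  rw [← himage] at hmem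
  obtain ⟨m, hm, rfl⟩ := Finset.mem_image.mp hmem
  exact ⟨m, Finset.mem_range.mp hm, rfl⟩

lemma GaussianInt.I_pow_four : (⟨0, 1⟩ : GaussianInt) ^ 4 = 1 := by decide

lemma GaussianInt.I_pow_mod_four (m : ℕ) : (⟨0, 1⟩ : GaussianInt) ^ m = ⟨0, 1⟩ ^ (m % 4) :=
  pow_eq_pow_mod m GaussianInt.I_pow_four

lemma exists_mulChar_apply_eq_I {β : ZMod N} (hβ : orderOf β = N - 1) (h4 : 4 ∣ N - 1) :
    ∃ ψ : MulChar (ZMod N) GaussianInt, ψ β = ⟨0, 1⟩ := by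
  have hgen : ∀ x, x ∈ Subgroup.zpowers (Units.mk0 β (ne_zero_of_orderOf_eq hβ)) := fun x ↦ by
    obtain ⟨m, -, hm⟩ := exists_pow_eq_of_orderOf_eq hβ x.ne_zero
    exact ⟨m, Units.ext (by simp [hm])⟩
  let ζ : GaussianIntˣ := ⟨⟨0, 1⟩, ⟨0, -1⟩, by decide, by decide⟩
  have hζ : ζ ∈ rootsOfUnity (Fintype.card (ZMod N)ˣ) GaussianInt := by
    obtain ⟨k, hk⟩ := h4
    rw [mem_rootsOfUnity, ZMod.card_units, hk, pow_mul]
    have : ζ ^ 4 = 1 := Units.ext GaussianInt.I_pow_four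
    rw [this, one_pow]
  exact ⟨MulChar.ofRootOfUnity hζ hgen, MulChar.ofRootOfUnity_spec hζ hgen⟩

lemma mem_Dclass_iff {f : ℕ} (hN : N = 4 * f + 1) {β : ZMod N} (hβ : orderOf β = N - 1)
    {ψ : MulChar (ZMod N) GaussianInt} (hψ : ψ β = ⟨0, 1⟩) {j : ℕ} (hj : j < 4) (x : ZMod N) :
    x ∈ Dclass N f β j ↔ ψ x = ⟨0, 1⟩ ^ j := by
  constructor
  · rintro ⟨k, -, rfl⟩
    rw [map_pow, hψ, GaussianInt.I_pow_mod_four, Nat.mul_add_mod, Nat.mod_eq_of_lt hj]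
  · intro h
    have hx : x ≠ 0 := by
      rintro rfl
      rw [MulChar.map_zero] at h
      interval_cases j <;> revert h <;> decide
    obtain ⟨m, hm, rfl⟩ := exists_pow_eq_of_orderOf_eq hβ hx
    rw [map_pow, hψ, GaussianInt.I_pow_mod_four] at h
    have hr : m % 4 = j := by
      have := Nat.mod_lt m (show 4 > 0 by norm_num)
      generalize m % 4 = r at *
      interval_cases j <;> interval_cases r <;> revert h <;> decide
    exact ⟨m / 4, by omega, by rw [← hr, Nat.div_add_mod]⟩

lemma neg_one_pow_chiSeq_zero_one {f : ℕ} (hN : N = 4 * f + 1) {β : ZMod N}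
    (hβ : orderOf β = N - 1) {ψ : MulChar (ZMod N) GaussianInt} (hψ : ψ β = ⟨0, 1⟩) (t : ℤ) :
    (-1 : ℤ) ^ chiSeq N (Dclass N f β 0 ∪ Dclass N f β 1) t =
      -((ψ t).re + (ψ t).im) + if (t : ZMod N) = 0 then 1 else 0 := by
  simp only [chiSeq, Set.mem_union, mem_Dclass_iff hN hβ hψ (show 0 < 4 by norm_num),
    mem_Dclass_iff hN hβ hψ (show 1 < 4 by norm_num)]
  rcases eq_or_ne (t : ZMod N) 0 with h0 | h0
  · rw [h0, MulChar.map_zero]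
    simp [Zsqrtd.ext_iff]
  · rcases GaussianInt.eq_of_isUnit ((isUnit_iff_ne_zero.mpr h0).map ψ) with h | h | h | h <;>
      simp [h, h0, Zsqrtd.ext_iff]

lemma neg_one_pow_chiSeq_one_two {f : ℕ} (hN : N = 4 * f + 1) {β : ZMod N}
    (hβ : orderOf β = N - 1) {ψ : MulChar (ZMod N) GaussianInt} (hψ : ψ β = ⟨0, 1⟩) (t : ℤ) :
    (-1 : ℤ) ^ chiSeq N (Dclass N f β 1 ∪ Dclass N f β 2) t =
      (ψ t).re - (ψ t).im + if (t : ZMod N) = 0 then 1 else 0 := by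
  simp only [chiSeq, Set.mem_union, mem_Dclass_iff hN hβ hψ (show 1 < 4 by norm_num),
    mem_Dclass_iff hN hβ hψ (show 2 < 4 by norm_num)]
  rcases eq_or_ne (t : ZMod N) 0 with h0 | h0
  · rw [h0, MulChar.map_zero]
    simp [Zsqrtd.ext_iff, pow_two]
  · rcases GaussianInt.eq_of_isUnit ((isUnit_iff_ne_zero.mpr h0).map ψ) with h | h | h | h <;>
      simp [h, h0, Zsqrtd.ext_iff, pow_two]

lemma sum_range_natCast {A : Type*} [AddCommMonoid A] (F : ZMod N → A) :
    ∑ i ∈ Finset.range N, F i = ∑ x, F x :=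
  Finset.sum_nbij' (fun i ↦ (i : ZMod N)) ZMod.val (fun _ _ ↦ Finset.mem_univ _)
    (fun x _ ↦ Finset.mem_range.mpr x.val_lt)
    (fun _ hi ↦ ZMod.val_cast_of_lt (Finset.mem_range.mp hi))
    (fun x _ ↦ ZMod.natCast_zmod_val x) (fun _ _ ↦ rfl)

lemma corr_chiSeq_Dclass {f : ℕ} (hN : N = 4 * f + 1) {β : ZMod N}
    (hβ : orderOf β = N - 1) {ψ : MulChar (ZMod N) GaussianInt} (hψβ : ψ β = ⟨0, 1⟩)
    (hneg : ψ (-1) = -1) (hψ : ψ * ψ ≠ 1) (τ : ℤ) :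
    corr N (chiSeq N (Dclass N f β 1 ∪ Dclass N f β 2))
        (chiSeq N (Dclass N f β 0 ∪ Dclass N f β 1)) τ =
      (ψ τ * ψ τ * jacobiSum ψ ψ).re - 2 * (ψ τ).re + if (τ : ZMod N) = 0 then 1 else 0 := by
  rw [← sum_sign_mul_sign ψ hneg hψ, ← sum_range_natCast, corr]
  refine Finset.sum_congr rfl fun i _ ↦ ?_
  rw [pow_add, neg_one_pow_chiSeq_zero_one hN hβ hψβ, neg_one_pow_chiSeq_one_two hN hβ hψβ]
  push_cast
  rfl

end QuarticCharacter

/-- the cross-correlation `R_{v,u}`. -/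
theorem stmt3 (N f y : ℕ) (hprime : N.Prime) (hNf : N = 4 * f + 1) (hN5 : 5 ≤ N)
    (hfy : f = y ^ 2) (hy : 0 < y) (hfodd : Odd f)
    (β : ZMod N) (hβ : orderOf β = N - 1)
    (u v : ℤ → ℕ)
    (hu : u = chiSeq N (Dclass N f β 0 ∪ Dclass N f β 1))
    (hv : v = chiSeq N (Dclass N f β 1 ∪ Dclass N f β 2)) :
    ∀ τ : ℤ, 0 ≤ τ → τ < N →
      ((τ : ZMod N) ∈ Dclass N f β 0 → corr N v u τ = -3) ∧
      ((τ : ZMod N) ∉ Dclass N f β 0 → corr N v u τ = 1) := by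
  have : Fact N.Prime := ⟨hprime⟩
  have hyodd : Odd y := by rw [hfy] at hfodd; exact Nat.Odd.of_mul_left (by rwa [pow_two] at hfodd)
  have hβpow : β ^ (N - 1) = 1 := hβ ▸ pow_orderOf_eq_one β
  have hβ0 := ne_zero_of_orderOf_eq hβ
  obtain ⟨ψ, hψβ⟩ := exists_mulChar_apply_eq_I hβ ⟨f, by omega⟩
  have hψ : ψ * ψ ≠ 1 := by
    intro h
    have h' := DFunLike.congr_fun h β
    rw [MulChar.mul_apply, hψβ, MulChar.one_apply (isUnit_iff_ne_zero.mpr hβ0)] at h'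
    revert h'
    decide
  have hneg : ψ (-1) = -1 := by
    have hsq : β ^ (2 * f) * β ^ (2 * f) = 1 := by
      rw [← pow_add, ← hβpow]
      congr 1
      omega
    have hne : β ^ (2 * f) ≠ 1 := pow_ne_one_of_lt_orderOf (by omega) (by omega)
    have hhalf := (mul_self_eq_one_iff.mp hsq).resolve_left hne
    rw [← hhalf, map_pow, hψβ, pow_mul]
    exact hfodd.neg_one_pow
  have hψ2 : ψ 2 * ψ 2 = -1 := by
    have h20 : (2 : ZMod N) ≠ 0 := Ring.two_ne_zero (by rw [ZMod.ringChar_zmod_n]; omega)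
    obtain ⟨m, -, hm⟩ := exists_pow_eq_of_orderOf_eq hβ h20
    have hmodd : Odd m := by
      rw [← Nat.not_even_iff_odd]
      rintro ⟨k, rfl⟩
      have hsq : IsSquare (2 : ZMod N) := ⟨β ^ k, by rw [hm, pow_add]⟩
      rw [ZMod.exists_sq_eq_two_iff (by omega)] at hsq
      obtain ⟨l, hl⟩ := hfodd
      omega
    rw [hm, map_pow, hψβ, ← mul_pow]
    exact hmodd.neg_one_pow
  have hJ := re_jacobiSum_self (by rw [hNf, hfy]) hyodd ψ hψ2 hψ
  intro τ _ _
  rw [hu, hv, corr_chiSeq_Dclass hNf hβ hψβ hneg hψ, mem_Dclass_iff hNf hβ hψβ (by norm_num),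
    pow_zero]
  rcases eq_or_ne (τ : ZMod N) 0 with h0 | h0
  · simp [h0, MulChar.map_zero]
  · rcases GaussianInt.eq_of_isUnit ((isUnit_iff_ne_zero.mpr h0).map ψ) with h | h | h | h <;>
      simp [h, h0, hJ, Zsqrtd.ext_iff]
end

section
/- S_v(α) ∈ {0, 1} if and only if 2 mod N ∈ D_0. -/
open Finset Polynomial

/-- The sequence polynomial over F_2 of a sequence of period `n`. -/
noncomputable def Spoly (n : ℕ) (s : ℤ → ℕ) : Polynomial (ZMod 2) :=
  ∑ i ∈ Finset.range n, Polynomial.C ((s (i : ℤ) : ZMod 2)) * Polynomial.X ^ i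

/-- Summing over `ZMod N` through the powers of an element of order `4 * f = N - 1`, grouped by the
exponent modulo four. -/
theorem sum_eq_sum_pow_orderOf {N f : ℕ} (hprime : N.Prime) (hNf : N = 4 * f + 1)
    {β : ZMod N} (hβ : orderOf β = 4 * f) [Fintype (ZMod N)] {M : Type*} [AddCommMonoid M]
    (g : ZMod N → M) :
    ∑ x, g x = g 0 + ∑ k ∈ range f, ∑ j ∈ range 4, g (β ^ (4 * k + j)) := by
  classical
  have : Fact N.Prime := ⟨hprime⟩
  have hf : 0 < f := by have := hprime.two_le; omega
  have hβ0 : β ≠ 0 := by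
    rintro rfl
    have := pow_orderOf_eq_one (0 : ZMod N)
    rw [hβ, zero_pow (by omega)] at this
    exact zero_ne_one this
  have hinj : Set.InjOn (fun m : ℕ => β ^ m) (range (4 * f)) := by
    have := pow_injOn_Iio_orderOf (x := β)
    rw [hβ] at this
    intro a ha b hb hab
    exact this (by simpa using ha) (by simpa using hb) hab
  have h0 : (0 : ZMod N) ∉ (range (4 * f)).image (fun m : ℕ => β ^ m) := by
    simp only [mem_image, not_exists, not_and]
    exact fun m _ h => hβ0 (eq_zero_of_pow_eq_zero h)
  have huniv : (univ : Finset (ZMod N)) =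
      insert 0 ((range (4 * f)).image (fun m : ℕ => β ^ m)) := by
    symm
    apply Finset.eq_univ_of_card
    rw [card_insert_of_notMem h0, card_image_of_injOn hinj, card_range, ZMod.card, hNf]
  rw [huniv, sum_insert h0, sum_image hinj]
  congr 1
  clear huniv h0 hinj hf hβ hNf
  induction f with
  | zero => simp
  | succ n ih =>
    rw [sum_range_succ, ← ih, Nat.mul_succ, sum_range_add]

/-- Membership of a power of `β` in a cyclotomic class is read off the exponent modulo four. -/
theorem pow_mem_Dclass_iff_s13 {N f : ℕ} {β : ZMod N} (hβ : orderOf β = 4 * f)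
    {k j i : ℕ} (hk : k < f) (hj : j < 4) (hi : i < 4) :
    β ^ (4 * k + j) ∈ Dclass N f β i ↔ j = i := by
  constructor
  · rintro ⟨l, hl, h⟩
    have := pow_injOn_Iio_orderOf (x := β) (by simp only [Set.mem_Iio]; omega)
      (by simp only [Set.mem_Iio]; omega) h
    omega
  · rintro rfl
    exact ⟨k, hk, rfl⟩

/-- The sum of `α ^ i` over the cyclotomic class of index `j`. -/
noncomputable def classSum {N : ℕ} {F : Type*} [Field F] (f : ℕ) (β : ZMod N) (α : F) (j : ℕ) :
    F :=
  ∑ k ∈ range f, α ^ (β ^ (4 * k + j)).val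

theorem classSum_add_four {N f : ℕ} {F : Type*} [Field F] {β : ZMod N} (hβ : orderOf β = 4 * f)
    (α : F) (j : ℕ) : classSum f β α (j + 4) = classSum f β α j := by
  unfold classSum
  have h1 := sum_range_succ (fun k => α ^ (β ^ (4 * k + j)).val) f
  have h2 := sum_range_succ' (fun k => α ^ (β ^ (4 * k + j)).val) f
  have h3 : β ^ (4 * f + j) = β ^ (4 * 0 + j) := by
    rw [pow_add, ← hβ, pow_orderOf_eq_one]; simp
  rw [h1, h3] at h2
  have h4 := add_right_cancel h2
  rw [h4]
  refine sum_congr rfl fun k _ => ?_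
  congr 3
  ring

theorem classSum_add_four_mul {N f : ℕ} {F : Type*} [Field F] {β : ZMod N}
    (hβ : orderOf β = 4 * f) (α : F) (j q : ℕ) :
    classSum f β α (j + 4 * q) = classSum f β α j := by
  induction q with
  | zero => rfl
  | succ q ih => rw [Nat.mul_succ, ← add_assoc, classSum_add_four hβ, ih]

theorem classSum_sq {N f r : ℕ} [NeZero N] {F : Type*} [Field F] [CharP F 2] {β : ZMod N}
    (hr : β ^ r = 2) {α : F} (hα : α ^ N = 1) (j : ℕ) :
    classSum f β α j ^ 2 = classSum f β α (j + r) := by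
  unfold classSum
  rw [CharTwo.sum_sq]
  refine sum_congr rfl fun k _ => ?_
  rw [← add_assoc, pow_add β _ r, hr, mul_two, ZMod.val_add, ← mul_two, ← pow_mul]
  exact pow_eq_pow_mod _ hα

/-- `S_v(α) ∈ {0,1}` iff `2 mod N ∈ D_0`. -/
theorem stmt13 (N f : ℕ) (hprime : N.Prime) (hNf : N = 4 * f + 1) (hN5 : 5 ≤ N)
    (β : ZMod N) (hβ : orderOf β = N - 1)
    (F : Type*) [Field F] [Algebra (ZMod 2) F]
    (α : F) (hα : IsPrimitiveRoot α N)
    (v : ℤ → ℕ)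
    (hv : v = chiSeq N (Dclass N f β 1 ∪ Dclass N f β 2)) :
    Polynomial.aeval α (Spoly N v) ∈ ({0, 1} : Set F) ↔ (2 : ZMod N) ∈ Dclass N f β 0 := by
  classical
  have : Fact N.Prime := ⟨hprime⟩
  have : CharP F 2 := charP_of_injective_algebraMap (algebraMap (ZMod 2) F).injective 2
  have hord : orderOf β = 4 * f := by omega
  have hrange (h : ℕ → F) : ∑ i ∈ range N, h i = ∑ x : ZMod N, h x.val := by
    refine sum_nbij' (fun i => (i : ZMod N)) ZMod.val (by simp) ?_ ?_ (by simp) ?_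
    · intro x _; simpa using ZMod.val_lt x
    · intro i hi; exact ZMod.val_cast_of_lt (by simpa using hi)
    · intro i hi; rw [ZMod.val_cast_of_lt (by simpa using hi)]
  have hzero (i : ℕ) : (0 : ZMod N) ∉ Dclass N f β i := by
    rintro ⟨k, _, h⟩
    have hb : IsUnit β := IsUnit.of_pow_eq_one (pow_orderOf_eq_one β) (by omega)
    exact (hb.pow _).ne_zero h.symm
  have hS : Polynomial.aeval α (Spoly N v) = classSum f β α 1 + classSum f β α 2 := by
    have h1 : Polynomial.aeval α (Spoly N v) = ∑ i ∈ range N,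
        if (i : ZMod N) ∈ Dclass N f β 1 ∪ Dclass N f β 2 then α ^ i else 0 := by
      subst hv
      rw [Spoly, map_sum]
      refine sum_congr rfl fun i _ => ?_
      simp only [chiSeq, Int.cast_natCast]
      split_ifs <;> simp
    rw [h1, hrange, sum_eq_sum_pow_orderOf hprime hNf hord]
    simp only [ZMod.natCast_val, ZMod.cast_id', id, Set.mem_union, hzero, or_self, if_false,
      zero_add, classSum, ← sum_add_distrib]
    refine sum_congr rfl fun k hk => ?_
    have hk' := mem_range.1 hk
    have hiff (j i : ℕ) (hj : j < 4) (hi : i < 4) :=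
      pow_mem_Dclass_iff_s13 hord hk' hj hi
    simp only [sum_range_succ _ 3, sum_range_succ _ 2, sum_range_succ _ 1, sum_range_one]
    simp only [hiff, Nat.reduceLT]
    simp
  have htotal : classSum f β α 0 + classSum f β α 1 + classSum f β α 2 + classSum f β α 3 = 1 := by
    have h := hα.geom_sum_eq_zero (by omega)
    rw [hrange, sum_eq_sum_pow_orderOf hprime hNf hord] at h
    simp only [sum_range_succ _ 3, sum_range_succ _ 2, sum_range_succ _ 1, sum_range_one,
      sum_add_distrib, ZMod.val_zero, pow_zero] at h
    exact (CharTwo.add_eq_zero.1 h).symm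
  obtain ⟨r, hr⟩ : ∃ r, β ^ r = 2 := by
    have h2 : (2 : ZMod N) ≠ 0 := by
      intro h
      have := (ZMod.natCast_eq_zero_iff 2 N).1 (by exact_mod_cast h)
      have := Nat.le_of_dvd (by norm_num) this
      omega
    have h := sum_eq_sum_pow_orderOf hprime hNf hord (fun x => if x = 2 then 1 else 0)
    by_contra! hne
    simp [hne, h2.symm] at h
  have hper := classSum_add_four_mul hord α
  have hsq := classSum_sq (f := f) hr hα.pow_eq_one
  have hmem (s : F) : s ∈ ({0, 1} : Set F) ↔ s ^ 2 = s := by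
    rw [sq, ← IsIdempotentElem, IsIdempotentElem.iff_eq_zero_or_one]; rfl
  rw [hmem, hS, CharTwo.add_sq, hsq, hsq]
  constructor
  · intro h
    obtain ⟨q, i, hi, rfl⟩ : ∃ q i, i < 4 ∧ r = i + 4 * q :=
      ⟨r / 4, r % 4, Nat.mod_lt _ (by norm_num), by omega⟩
    simp only [← add_assoc, hper] at h hsq
    have h4 (j : ℕ) : classSum f β α (j + 4) = classSum f β α j := hper j 1
    have h40 := h4 0
    have h41 := h4 1
    have h42 := h4 2
    have h2 : (2 : F) = 0 := CharTwo.two_eq_zero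
    have hi0 : i = 0 := by
      have s0 := hsq 0
      have s1 := hsq 1
      have s2 := hsq 2
      have s3 := hsq 3
      simp only [zero_add, Nat.reduceAdd] at h40 h41 h42
      generalize classSum f β α = T at *
      interval_cases i
      · rfl
      all_goals
        exfalso
        simp only [zero_add, Nat.reduceAdd] at s0 s1 s2 s3 h
        grind
    subst hi0
    refine ⟨q % f, Nat.mod_lt _ (by omega), ?_⟩
    rw [← hr, add_zero, zero_add, ← Nat.mul_mod_mul_left, ← hord, pow_mod_orderOf]
  · rintro ⟨k, -, hk⟩
    have hr' : β ^ (4 * k) = 2 := hk.symm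
    have hsq' := classSum_sq (f := f) hr' hα.pow_eq_one
    rw [← hsq, ← hsq, hsq', hsq', hper, hper]
end
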